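/- For a Manin matrix M over an associative algebra, the MacMahon Master Theorem holds: [\operatorname{cdet}(1 - zM)]^{-1} = \sum_{m\ge 0} z^m \operatorname{tr}_{1,\ldots,m} H^{(m)} M_1 \cdots M_m, where H^{(m)} is the symmetrizer on (\mathbb{C}^N)^{\otimes m} and \operatorname{cdet}(1-zM) = \sum_{m=0}^N (-z)^m \operatorname{tr}_{1,\ldots,m} A^{(m)} M_1 \cdots M_m. -/

import Mathlib

noncomputable section
open scoped Classical

/- Operators in `(End ℂ^N)^{⊗m} ⊗ A` are modelled as matrices over `A` indexed
by functions `Fin m → Fin N`. -/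

variable {A : Type*} [Ring A] [Algebra ℂ A]

/-- `M` is a Manin matrix: `[M_{ij}, M_{kl}] = [M_{kj}, M_{il}]`. -/
def IsManin {N : ℕ} (M : Matrix (Fin N) (Fin N) A) : Prop :=
  ∀ i j k l : Fin N,
    M i j * M k l - M k l * M i j = M k j * M i l - M i l * M k j

/-- The copy `M_a` of `M` acting on the `a`-th tensor factor. -/
def Mfac (N : ℕ) (M : Matrix (Fin N) (Fin N) A) (m : ℕ) (a : Fin m) :
    Matrix (Fin m → Fin N) (Fin m → Fin N) A := fun f g =>
  if ∀ b : Fin m, b ≠ a → f b = g b then M (f a) (g a) else 0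

/-- The antisymmetrizer `A^{(m)}` on `(ℂ^N)^{⊗m}`, with scalar entries. -/
def AsymM (N m : ℕ) : Matrix (Fin m → Fin N) (Fin m → Fin N) A := fun f g =>
  algebraMap ℂ A ((m.factorial : ℂ)⁻¹ *
    ∑ σ : Equiv.Perm (Fin m),
      if ∀ b : Fin m, f b = g (σ b) then ((Equiv.Perm.sign σ : ℤ) : ℂ) else 0)

/-- The symmetrizer `H^{(m)}` on `(ℂ^N)^{⊗m}`, with scalar entries. -/
def HsymM (N m : ℕ) : Matrix (Fin m → Fin N) (Fin m → Fin N) A := fun f g =>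
  algebraMap ℂ A ((m.factorial : ℂ)⁻¹ *
    ∑ σ : Equiv.Perm (Fin m),
      if ∀ b : Fin m, f b = g (σ b) then 1 else 0)

/-- `M₁ M₂ ⋯ M_m`. -/
def prodM (N : ℕ) (M : Matrix (Fin N) (Fin N) A) (m : ℕ) :
    Matrix (Fin m → Fin N) (Fin m → Fin N) A :=
  (List.ofFn fun a : Fin m => Mfac N M m a).prod

/-- `tr_{1,…,m} A^{(m)} M₁ ⋯ M_m`, the coefficient of `z^m` in `cdet(1+zM)`. -/
def cdetCoeff (N : ℕ) (M : Matrix (Fin N) (Fin N) A) (m : ℕ) : A :=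
  Matrix.trace (AsymM N m * prodM N M m)

/-- `cdet(1+zM) = ∑_{m=0}^N z^m tr_{1,…,m} A^{(m)} M₁ ⋯ M_m` as a power series. -/
def cdetSeries (N : ℕ) (M : Matrix (Fin N) (Fin N) A) : PowerSeries A :=
  PowerSeries.mk fun m => if m ≤ N then cdetCoeff N M m else 0

/-- `cdet(1-zM) = ∑_{m=0}^N (-z)^m tr_{1,…,m} A^{(m)} M₁ ⋯ M_m`. -/
def cdetNegSeries (N : ℕ) (M : Matrix (Fin N) (Fin N) A) : PowerSeries A :=
  PowerSeries.mk fun m => if m ≤ N then ((-1 : ℤ) ^ m) • cdetCoeff N M m else 0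

/-- `∑_{m≥0} z^m tr_{1,…,m} H^{(m)} M₁ ⋯ M_m`. -/
def permSeries (N : ℕ) (M : Matrix (Fin N) (Fin N) A) : PowerSeries A :=
  PowerSeries.mk fun m => Matrix.trace (HsymM N m * prodM N M m)

open Equiv

section TwistedSum

variable {ι R : Type*} [Fintype ι] [DecidableEq ι] [Ring R]

/-- The permutations of `ι` that fix every point outside `S`. -/
def permsOn (S : Finset ι) : Finset (Perm ι) :=
  Finset.univ.filter fun σ => ∀ i, i ∉ S → σ i = i

lemma mem_permsOn {S : Finset ι} {σ : Perm ι} :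
    σ ∈ permsOn S ↔ ∀ i, i ∉ S → σ i = i := by
  simp [permsOn]

lemma mul_mem_permsOn {S : Finset ι} {σ τ : Perm ι} (hσ : σ ∈ permsOn S)
    (hτ : τ ∈ permsOn S) : σ * τ ∈ permsOn S := by
  rw [mem_permsOn] at *
  intro i hi
  rw [Perm.mul_apply, hτ i hi, hσ i hi]

lemma inv_mem_permsOn {S : Finset ι} {σ : Perm ι} (hσ : σ ∈ permsOn S) :
    σ⁻¹ ∈ permsOn S := by
  rw [mem_permsOn] at *
  intro i hi
  rw [Perm.inv_eq_iff_eq, hσ i hi]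

lemma permsOn_mono {S T : Finset ι} (h : S ⊆ T) : permsOn S ⊆ permsOn T := by
  intro σ hσ
  rw [mem_permsOn] at *
  exact fun i hi => hσ i fun hS => hi (h hS)

lemma swap_mem_permsOn {S : Finset ι} {i j : ι} (hi : i ∈ S) (hj : j ∈ S) :
    swap i j ∈ permsOn S := by
  rw [mem_permsOn]
  intro a ha
  exact swap_apply_of_ne_of_ne (fun h => ha (h ▸ hi)) (fun h => ha (h ▸ hj))

lemma apply_mem_of_mem_permsOn {S : Finset ι} {σ : Perm ι} (hσ : σ ∈ permsOn S) {i : ι}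
    (hi : i ∈ S) : σ i ∈ S := by
  by_contra h
  have := mem_permsOn.1 hσ _ h
  rw [σ.injective this] at h
  exact h hi

lemma swap_mul_mem_permsOn {S : Finset ι} {x : ι} {σ : Perm ι}
    (hσ : σ ∈ permsOn (insert x S)) : swap x (σ x) * σ ∈ permsOn S := by
  have hxm := Finset.mem_insert_self x S
  have h2 := mul_mem_permsOn (swap_mem_permsOn hxm (apply_mem_of_mem_permsOn hσ hxm)) hσ
  rw [mem_permsOn] at h2 ⊢
  intro i hi
  by_cases hix : i = x
  · subst hix; simp
  · exact h2 i (by simp [hix, hi])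

lemma permsOn_empty : permsOn (∅ : Finset ι) = {1} := by
  ext σ
  simp [mem_permsOn, Equiv.ext_iff]

/-- Every permutation supported on `insert x S` is uniquely a transposition `(x i)` times
a permutation supported on `S`. -/
lemma sum_permsOn_insert {B : Type*} [AddCommMonoid B] {S : Finset ι} {x : ι} (hx : x ∉ S)
    (F : Perm ι → B) :
    ∑ σ ∈ permsOn (insert x S), F σ
      = ∑ i ∈ insert x S, ∑ τ ∈ permsOn S, F (swap x i * τ) := by
  rw [← Finset.sum_product']
  refine Finset.sum_bij' (fun σ _ => (σ x, swap x (σ x) * σ)) (fun q _ => swap x q.1 * q.2)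
    ?_ ?_ ?_ ?_ ?_
  · intro σ hσ
    have hxm := Finset.mem_insert_self x S
    have h1 := apply_mem_of_mem_permsOn hσ hxm
    rw [Finset.mem_product]
    exact ⟨h1, swap_mul_mem_permsOn hσ⟩
  · rintro ⟨i, τ⟩ h
    rw [Finset.mem_product] at h
    exact mul_mem_permsOn (swap_mem_permsOn (Finset.mem_insert_self x S) h.1)
      (permsOn_mono (Finset.subset_insert x S) h.2)
  · intro σ _
    simp [← mul_assoc]
  · rintro ⟨i, τ⟩ h
    rw [Finset.mem_product] at h
    have h3 : τ x = x := mem_permsOn.1 h.2 x hx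
    simp [h3, ← mul_assoc]
  · intro σ _
    simp [← mul_assoc]

lemma card_permsOn (S : Finset ι) : (permsOn S).card = S.card.factorial := by
  induction S using Finset.induction_on with
  | empty => simp [permsOn_empty]
  | insert x S hx ih =>
    have := sum_permsOn_insert hx (fun _ => 1)
    simp only [Finset.sum_const, smul_eq_mul, mul_one] at this
    rw [this, ih, Finset.card_insert_of_notMem hx, Nat.factorial_succ]

/-- Permutations supported on `S` are generated by transpositions of elements of `S`. -/
lemma permsOn_induction {S : Finset ι} {P : Perm ι → Prop} (one : P 1)
    (swap_mul : ∀ i ∈ S, ∀ j ∈ S, ∀ σ, P σ → P (swap i j * σ)) {σ : Perm ι}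
    (hσ : σ ∈ permsOn S) : P σ := by
  induction S using Finset.induction_on generalizing σ with
  | empty =>
    rw [permsOn_empty, Finset.mem_singleton] at hσ
    exact hσ ▸ one
  | insert x S hx ih =>
    have hxm := Finset.mem_insert_self x S
    have h1 := apply_mem_of_mem_permsOn hσ hxm
    have h2 : swap x (σ x) * σ ∈ permsOn S := swap_mul_mem_permsOn hσ
    have h3 := swap_mul x hxm _ h1 _ (ih (fun i hi j hj σ h => swap_mul i
      (Finset.mem_insert_of_mem hi) j (Finset.mem_insert_of_mem hj) σ h) h2)
    simpa [← mul_assoc] using h3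

variable (ρ : Perm ι →* R) (χ : Perm ι →* ℤˣ)

/-- The unnormalized (anti)symmetrizer `∑ χ(σ) ρ(σ)` over the permutations supported on `S`. -/
def twistedSum (S : Finset ι) : R := ∑ σ ∈ permsOn S, ((χ σ : ℤˣ) : ℤ) • ρ σ

lemma units_int_smul_smul {B : Type*} [AddCommGroup B] (u : ℤˣ) (b : B) :
    (u : ℤ) • (u : ℤ) • b = b := by
  rw [smul_smul, ← Units.val_mul, Int.units_mul_self, Units.val_one, one_smul]

variable {ρ χ}

lemma map_mul_twistedSum {S : Finset ι} {σ : Perm ι} (hσ : σ ∈ permsOn S) :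
    ρ σ * twistedSum ρ χ S = ((χ σ : ℤˣ) : ℤ) • twistedSum ρ χ S := by
  rw [twistedSum, Finset.mul_sum, Finset.smul_sum]
  refine Finset.sum_bij' (fun τ _ => σ * τ) (fun τ _ => σ⁻¹ * τ)
    (fun τ hτ => mul_mem_permsOn hσ hτ)
    (fun τ hτ => mul_mem_permsOn (inv_mem_permsOn hσ) hτ) (by simp) (by simp) ?_
  intro τ _
  rw [map_mul, map_mul, Units.val_mul, mul_smul, units_int_smul_smul, mul_smul_comm]

lemma twistedSum_mul_map {S : Finset ι} {σ : Perm ι} (hσ : σ ∈ permsOn S) :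
    twistedSum ρ χ S * ρ σ = ((χ σ : ℤˣ) : ℤ) • twistedSum ρ χ S := by
  rw [twistedSum, Finset.sum_mul, Finset.smul_sum]
  refine Finset.sum_bij' (fun τ _ => τ * σ) (fun τ _ => τ * σ⁻¹)
    (fun τ hτ => mul_mem_permsOn hτ hσ)
    (fun τ hτ => mul_mem_permsOn hτ (inv_mem_permsOn hσ)) (by simp) (by simp) ?_
  intro τ _
  rw [map_mul, map_mul, mul_comm (χ τ), Units.val_mul, mul_smul, units_int_smul_smul,
    smul_mul_assoc]

/-- If `Y` transforms on the left by `χ` under permutations supported on `S`, then the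
`χ`-twisted sum acts on `Y` as the scalar `|S|!`. -/
lemma twistedSum_mul_of_map_mul {S : Finset ι} {Y : R}
    (h : ∀ σ ∈ permsOn S, ρ σ * Y = ((χ σ : ℤˣ) : ℤ) • Y) :
    twistedSum ρ χ S * Y = S.card.factorial • Y := by
  rw [twistedSum, Finset.sum_mul, ← card_permsOn, ← Finset.sum_const]
  refine Finset.sum_congr rfl fun σ hσ => ?_
  rw [smul_mul_assoc, h σ hσ, units_int_smul_smul]

lemma mul_twistedSum_of_mul_map {S : Finset ι} {Y : R}
    (h : ∀ σ ∈ permsOn S, Y * ρ σ = ((χ σ : ℤˣ) : ℤ) • Y) :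
    Y * twistedSum ρ χ S = S.card.factorial • Y := by
  rw [twistedSum, Finset.mul_sum, ← card_permsOn, ← Finset.sum_const]
  refine Finset.sum_congr rfl fun σ hσ => ?_
  rw [mul_smul_comm, h σ hσ, units_int_smul_smul]

lemma twistedSum_mul_twistedSum {S T : Finset ι} (h : S ⊆ T) :
    twistedSum ρ χ S * twistedSum ρ χ T = S.card.factorial • twistedSum ρ χ T :=
  twistedSum_mul_of_map_mul fun _ hσ => map_mul_twistedSum (permsOn_mono h hσ)

lemma twistedSum_mul_twistedSum' {S T : Finset ι} (h : S ⊆ T) :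
    twistedSum ρ χ T * twistedSum ρ χ S = S.card.factorial • twistedSum ρ χ T :=
  mul_twistedSum_of_mul_map fun _ hσ => twistedSum_mul_map (permsOn_mono h hσ)

lemma twistedSum_insert {S : Finset ι} {x : ι} (hx : x ∉ S) :
    twistedSum ρ χ (insert x S) = twistedSum ρ χ S
      + ∑ i ∈ S, ((χ (swap x i) : ℤˣ) : ℤ) • (ρ (swap x i) * twistedSum ρ χ S) := by
  have key : ∀ i, ∑ τ ∈ permsOn S, ((χ (swap x i * τ) : ℤˣ) : ℤ) • ρ (swap x i * τ)
      = ((χ (swap x i) : ℤˣ) : ℤ) • (ρ (swap x i) * twistedSum ρ χ S) := by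
    intro i
    rw [twistedSum, Finset.mul_sum, Finset.smul_sum]
    refine Finset.sum_congr rfl fun τ _ => ?_
    rw [map_mul, map_mul, Units.val_mul, mul_smul, mul_smul_comm]
  rw [twistedSum, sum_permsOn_insert hx, Finset.sum_congr rfl fun i _ => key i,
    Finset.sum_insert hx]
  congr 1
  have h1 : swap x x = 1 := swap_self x
  rw [h1, map_one, map_one, Units.val_one, one_smul, one_mul]

lemma twistedSum_commute {χ' : Perm ι →* ℤˣ} {S T : Finset ι} (h : Disjoint S T) :
    Commute (twistedSum ρ χ S) (twistedSum ρ χ' T) := by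
  refine Commute.sum_left _ _ _ fun σ hσ => Commute.sum_right _ _ _ fun τ hτ => ?_
  refine Commute.smul_left (Commute.smul_right ?_ _) _
  refine Commute.map (Perm.Disjoint.commute fun i => ?_) ρ
  by_cases hi : i ∈ S
  · exact Or.inr (mem_permsOn.1 hτ i (Finset.disjoint_left.1 h hi))
  · exact Or.inl (mem_permsOn.1 hσ i hi)

/-- The sandwiched transpositions `p (i j) p`, with `p` the product of the twisted sums over
disjoint `S ∋ i` and `T ∋ j`, do not depend on `i` and `j`. -/
lemma exists_sandwich_swap_eq {χ' : Perm ι →* ℤˣ} {S T : Finset ι} (h : Disjoint S T) :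
    ∃ z : R, ∀ i ∈ S, ∀ j ∈ T,
      twistedSum ρ χ S * twistedSum ρ χ' T * ρ (swap i j)
        * (twistedSum ρ χ S * twistedSum ρ χ' T) = z := by
  rcases S.eq_empty_or_nonempty with rfl | ⟨i₀, hi₀⟩
  · exact ⟨0, by simp⟩
  rcases T.eq_empty_or_nonempty with rfl | ⟨j₀, hj₀⟩
  · exact ⟨0, by simp⟩
  refine ⟨twistedSum ρ χ S * twistedSum ρ χ' T * ρ (swap i₀ j₀)
    * (twistedSum ρ χ S * twistedSum ρ χ' T), fun i hi j hj => ?_⟩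
  have hg := swap_mem_permsOn hi₀ hi
  have hk := swap_mem_permsOn hj₀ hj
  set g := swap i₀ i with hgdef
  set k := swap j₀ j with hkdef
  have hconj : swap i j = g * k * swap i₀ j₀ * (k * g) := by
    have h1 := Equiv.swap_apply_apply (g * k) i₀ j₀
    have h2 : (g * k) i₀ = i := by
      rw [Perm.mul_apply, mem_permsOn.1 hk i₀ (Finset.disjoint_left.1 h hi₀), hgdef,
        swap_apply_left]
    have h3 : (g * k) j₀ = j := by
      rw [Perm.mul_apply, hkdef, swap_apply_left,
        mem_permsOn.1 hg j (Finset.disjoint_right.1 h hj)]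
    rw [h2, h3] at h1
    rw [h1, mul_inv_rev, hgdef, hkdef, swap_inv, swap_inv]
  have hc := (twistedSum_commute (ρ := ρ) (χ := χ) (χ' := χ') h).eq
  have hl : twistedSum ρ χ S * twistedSum ρ χ' T * ρ (g * k)
      = ((χ g : ℤˣ) : ℤ) • ((χ' k : ℤˣ) : ℤ) • (twistedSum ρ χ S * twistedSum ρ χ' T) := by
    rw [map_mul, hc, mul_assoc, ← mul_assoc _ (ρ g), twistedSum_mul_map hg, smul_mul_assoc,
      mul_smul_comm, ← mul_assoc, ← hc, mul_assoc, twistedSum_mul_map hk, mul_smul_comm]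
  have hr : ρ (k * g) * (twistedSum ρ χ S * twistedSum ρ χ' T)
      = ((χ g : ℤˣ) : ℤ) • ((χ' k : ℤˣ) : ℤ) • (twistedSum ρ χ S * twistedSum ρ χ' T) := by
    rw [map_mul, mul_assoc, ← mul_assoc (ρ g), map_mul_twistedSum hg, smul_mul_assoc,
      mul_smul_comm, hc, ← mul_assoc, map_mul_twistedSum hk, smul_mul_assoc]
  rw [hconj, map_mul, map_mul, ← mul_assoc _ (ρ (g * k) * _), ← mul_assoc _ (ρ (g * k)), hl,
    mul_assoc _ (ρ (k * g)), hr]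
  simp only [smul_mul_assoc, mul_smul_comm]
  rw [smul_comm (M := ℤ) (N := ℤ) ((χ' k : ℤˣ) : ℤ) ((χ g : ℤˣ) : ℤ), units_int_smul_smul,
    units_int_smul_smul]

/-- Adjoining `x ∈ T` to `S`: the sandwich of the larger twisted sum. -/
lemma twistedSum_insert_sandwich {χ' : Perm ι →* ℤˣ} {S T : Finset ι} (h : Disjoint S T)
    {x : ι} (hx : x ∈ T) {ε : ℤ} (hε : ∀ i ∈ S, ((χ (swap x i) : ℤˣ) : ℤ) = ε) {z : R}
    (hz : ∀ i ∈ S, twistedSum ρ χ S * twistedSum ρ χ' T * ρ (swap x i)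
        * (twistedSum ρ χ S * twistedSum ρ χ' T) = z) :
    (S.card.factorial * S.card.factorial) •
        (twistedSum ρ χ' T * twistedSum ρ χ (insert x S) * twistedSum ρ χ' T)
      = S.card.factorial •
        ((S.card.factorial * T.card.factorial) • (twistedSum ρ χ S * twistedSum ρ χ' T)
          + S.card • ε • z) := by
  have hc := (twistedSum_commute (ρ := ρ) (χ := χ) (χ' := χ') h).eq
  have hxS : x ∉ S := Finset.disjoint_right.1 h hx
  have hee := twistedSum_mul_twistedSum (ρ := ρ) (χ := χ) (Finset.Subset.refl S)
  have hff := twistedSum_mul_twistedSum (ρ := ρ) (χ := χ') (Finset.Subset.refl T)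
  have h1 := twistedSum_mul_twistedSum (ρ := ρ) (χ := χ) (Finset.subset_insert x S)
  have h2 := twistedSum_mul_twistedSum' (ρ := ρ) (χ := χ) (Finset.subset_insert x S)
  have h3 := twistedSum_insert (ρ := ρ) (χ := χ) hxS
  set e := twistedSum ρ χ S
  set f := twistedSum ρ χ' T
  set e' := twistedSum ρ χ (insert x S)
  have hpp : e * f * (e * f) = (S.card.factorial * T.card.factorial) • (e * f) := by
    rw [mul_assoc, ← mul_assoc f e, ← hc, mul_assoc e f f, hff, mul_smul_comm,
      mul_smul_comm, ← mul_assoc, hee, smul_mul_assoc, smul_smul, mul_comm]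
  have hl : e * f * e' * (e * f) = (S.card.factorial * S.card.factorial) • (f * e' * f) := by
    calc e * f * e' * (e * f) = f * e * e' * (e * f) := by rw [← hc]
      _ = f * (e * e') * e * f := by simp only [mul_assoc]
      _ = _ := by
        rw [h1, mul_smul_comm, smul_mul_assoc, smul_mul_assoc, mul_assoc f, h2, mul_smul_comm,
          smul_mul_assoc, smul_smul]
  have hep : e * (e * f) = S.card.factorial • (e * f) := by
    rw [← mul_assoc, hee, smul_mul_assoc]
  rw [← hl, h3, mul_add, add_mul, mul_assoc _ e (e * f), hep, mul_smul_comm, hpp, smul_add]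
  congr 1
  rw [Finset.mul_sum, Finset.sum_mul, ← Finset.sum_const, Finset.smul_sum]
  refine Finset.sum_congr rfl fun i hi => ?_
  rw [hε i hi, mul_smul_comm, smul_mul_assoc, mul_assoc, mul_assoc (ρ _), hep, mul_smul_comm,
    mul_smul_comm, ← mul_assoc, hz i hi, smul_comm]

end TwistedSum

section TraceRelation

variable {R B : Type*} [Ring R]

lemma nsmul_right_cancel {B : Type*} [AddCommGroup B] [Module ℂ B] {n : ℕ} (hn : n ≠ 0)
    {a b : B} (h : n • a = n • b) : a = b := by
  rw [← Nat.cast_smul_eq_nsmul ℂ, ← Nat.cast_smul_eq_nsmul ℂ n b] at h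
  exact smul_right_injective B (Nat.cast_ne_zero.2 hn) h

/-- Permutations supported on an interval of `Fin n` are generated by the adjacent
transpositions of that interval. -/
lemma permsOn_subset_of_adjacent {n : ℕ} {S : Finset (Fin n)}
    (hS : (S : Set (Fin n)).OrdConnected) (K : Submonoid (Perm (Fin n)))
    (hK : ∀ i ∈ S, ∀ j ∈ S, i.val + 1 = j.val → swap i j ∈ K) {σ : Perm (Fin n)}
    (hσ : σ ∈ permsOn S) : σ ∈ K := by
  have hlt : ∀ d : ℕ, ∀ i ∈ S, ∀ j ∈ S, i.val + d + 1 = j.val → swap i j ∈ K := by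
    intro d
    induction d with
    | zero => exact fun i hi j hj h => hK i hi j hj h
    | succ d ih =>
      intro i hi j hj h
      obtain ⟨t, ht⟩ : ∃ t : Fin n, t.val = i.val + d + 1 := ⟨⟨i.val + d + 1, by omega⟩, rfl⟩
      have htS : t ∈ S := hS.out hi hj ⟨Fin.le_def.2 (by omega), Fin.le_def.2 (by omega)⟩
      have h1 := ih i hi t htS ht.symm
      have h2 := hK t htS j hj (by omega)
      have h3 : swap t j * swap i t * swap t j = swap j i :=
        swap_mul_swap_mul_swap (by rw [Ne, Fin.ext_iff]; omega) (by rw [Ne, Fin.ext_iff]; omega)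
      rw [swap_comm, ← h3]
      exact K.mul_mem (K.mul_mem h2 h1) h2
  refine permsOn_induction (P := (· ∈ K)) K.one_mem (fun i hi j hj τ hτ => K.mul_mem ?_ hτ) hσ
  rcases lt_trichotomy i j with h | h | h
  · exact hlt (j.val - i.val - 1) i hi j hj (by have := Fin.lt_def.1 h; omega)
  · rw [h, swap_self]; exact K.one_mem
  · rw [swap_comm]
    exact hlt (i.val - j.val - 1) j hj i hi (by have := Fin.lt_def.1 h; omega)

variable {n : ℕ} {ρ : Perm (Fin n) →* R} {X : R}

lemma map_mul_of_adjacent {χ : Perm (Fin n) →* ℤˣ} {S : Finset (Fin n)}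
    (hS : (S : Set (Fin n)).OrdConnected) {Y : R}
    (h : ∀ i ∈ S, ∀ j ∈ S, i.val + 1 = j.val →
      ρ (swap i j) * Y = ((χ (swap i j) : ℤˣ) : ℤ) • Y)
    (σ : Perm (Fin n)) (hσ : σ ∈ permsOn S) : ρ σ * Y = ((χ σ : ℤˣ) : ℤ) • Y := by
  let K : Submonoid (Perm (Fin n)) :=
    { carrier := {σ | ρ σ * Y = ((χ σ : ℤˣ) : ℤ) • Y}
      one_mem' := by simp
      mul_mem' := by
        intro σ τ hσ hτ
        simp only [Set.mem_ofPred_eq] at *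
        rw [map_mul, map_mul, mul_assoc, hτ, mul_smul_comm, hσ, Units.val_mul, smul_smul,
          mul_comm] }
  exact permsOn_subset_of_adjacent hS K h hσ

lemma mul_map_of_adjacent {χ : Perm (Fin n) →* ℤˣ} {S : Finset (Fin n)}
    (hS : (S : Set (Fin n)).OrdConnected) {Y : R}
    (h : ∀ i ∈ S, ∀ j ∈ S, i.val + 1 = j.val →
      Y * ρ (swap i j) = ((χ (swap i j) : ℤˣ) : ℤ) • Y)
    (σ : Perm (Fin n)) (hσ : σ ∈ permsOn S) : Y * ρ σ = ((χ σ : ℤˣ) : ℤ) • Y := by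
  let K : Submonoid (Perm (Fin n)) :=
    { carrier := {σ | Y * ρ σ = ((χ σ : ℤˣ) : ℤ) • Y}
      one_mem' := by simp
      mul_mem' := by
        intro σ τ hσ hτ
        simp only [Set.mem_ofPred_eq] at *
        rw [map_mul, map_mul, ← mul_assoc, hσ, smul_mul_assoc, hτ, Units.val_mul, smul_smul] }
  exact permsOn_subset_of_adjacent hS K h hσ

lemma sign_swap_int {i j : Fin n} (h : i ≠ j) : ((Perm.sign (swap i j) : ℤˣ) : ℤ) = -1 := by
  rw [Perm.sign_swap h]; rfl

variable [AddCommGroup B] {tr : R →+ B}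

lemma trace_twistedSum_comm (htr : ∀ σ Y, tr (ρ σ * Y) = tr (Y * ρ σ))
    (χ : Perm (Fin n) →* ℤˣ) (S : Finset (Fin n)) (Y : R) :
    tr (twistedSum ρ χ S * Y) = tr (Y * twistedSum ρ χ S) := by
  simp only [twistedSum, Finset.sum_mul, Finset.mul_sum, map_sum]
  refine Finset.sum_congr rfl fun σ _ => ?_
  rw [smul_mul_assoc, mul_smul_comm, map_zsmul, map_zsmul, htr]

variable [Module ℂ R]

/-- The abstract form of the Manin relation: `(1 - s) X (1 + s) = 0` for every adjacent
transposition `s`. -/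
def ManinRel (ρ : Perm (Fin n) →* R) (X : R) : Prop :=
  ∀ i j : Fin n, i.val + 1 = j.val →
    (1 - ρ (swap i j)) * X * (1 + ρ (swap i j)) = 0

lemma ManinRel.symm_mul (hX : ManinRel ρ X) {T : Finset (Fin n)}
    (hT : (T : Set (Fin n)).OrdConnected) :
    twistedSum ρ 1 T * (X * twistedSum ρ 1 T)
      = T.card.factorial • (X * twistedSum ρ 1 T) := by
  refine twistedSum_mul_of_map_mul (map_mul_of_adjacent hT fun i hi j hj hij => ?_)
  have h1 := map_mul_twistedSum (ρ := ρ) (χ := 1) (swap_mem_permsOn hi hj)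
  simp only [MonoidHom.one_apply, Units.val_one, one_smul] at h1 ⊢
  refine nsmul_right_cancel two_ne_zero ?_
  have h2 := congrArg (· * twistedSum ρ 1 T) (hX i j hij)
  simp only [zero_mul, mul_assoc, add_mul, one_mul] at h2
  rw [h1, ← two_nsmul, mul_smul_comm, mul_smul_comm, sub_mul, one_mul, smul_sub, sub_eq_zero] at h2
  exact h2.symm

lemma ManinRel.mul_antisymm (hX : ManinRel ρ X) {S : Finset (Fin n)}
    (hS : (S : Set (Fin n)).OrdConnected) :
    twistedSum ρ Perm.sign S * X * twistedSum ρ Perm.sign S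
      = S.card.factorial • (twistedSum ρ Perm.sign S * X) := by
  refine mul_twistedSum_of_mul_map (mul_map_of_adjacent hS fun i hi j hj hij => ?_)
  have h1 := twistedSum_mul_map (ρ := ρ) (χ := Perm.sign) (swap_mem_permsOn hi hj)
  have hne : i ≠ j := by rw [Ne, Fin.ext_iff]; omega
  rw [sign_swap_int hne, neg_one_smul] at h1 ⊢
  refine nsmul_right_cancel two_ne_zero ?_
  have h2 := congrArg (twistedSum ρ Perm.sign S * ·) (hX i j hij)
  simp only [mul_zero, ← mul_assoc, mul_sub, mul_one] at h2
  rw [h1, sub_neg_eq_add, ← two_nsmul, smul_mul_assoc, smul_mul_assoc, mul_add, mul_one, smul_add]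
    at h2
  rw [smul_neg]
  exact eq_neg_of_add_eq_zero_right h2

variable [Module ℂ B]

/-- The first `k` elements of `Fin n`. -/
def lowPart (n k : ℕ) : Finset (Fin n) := Finset.univ.filter fun i => i.val < k

/-- The elements of `Fin n` from `k` on. -/
def highPart (n k : ℕ) : Finset (Fin n) := Finset.univ.filter fun i => k ≤ i.val

lemma lowPart_ordConnected (n k : ℕ) : (lowPart n k : Set (Fin n)).OrdConnected := by
  refine ⟨fun i _ j hj t ht => ?_⟩
  simp only [lowPart, Finset.coe_filter, Finset.mem_univ, true_and, Set.mem_ofPred_eq] at *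
  exact lt_of_le_of_lt ht.2 hj

lemma highPart_ordConnected (n k : ℕ) : (highPart n k : Set (Fin n)).OrdConnected := by
  refine ⟨fun i hi j _ t ht => ?_⟩
  simp only [highPart, Finset.coe_filter, Finset.mem_univ, true_and, Set.mem_ofPred_eq] at *
  exact le_trans hi ht.1

lemma disjoint_lowPart_highPart (n k : ℕ) : Disjoint (lowPart n k) (highPart n k) := by
  rw [Finset.disjoint_left]
  simp [lowPart, highPart]

lemma lowPart_succ {k : ℕ} (h : k < n) : lowPart n (k + 1) = insert ⟨k, h⟩ (lowPart n k) := by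
  ext i
  simp only [lowPart, Finset.mem_filter, Finset.mem_univ, true_and, Finset.mem_insert,
    Fin.ext_iff]
  omega

lemma highPart_eq_insert {k : ℕ} (h : k < n) :
    highPart n k = insert ⟨k, h⟩ (highPart n (k + 1)) := by
  ext i
  simp only [highPart, Finset.mem_filter, Finset.mem_univ, true_and, Finset.mem_insert,
    Fin.ext_iff]
  omega

lemma card_lowPart {k : ℕ} (h : k ≤ n) : (lowPart n k).card = k := by
  induction k with
  | zero => simp [lowPart]
  | succ k ih =>
    rw [lowPart_succ h, Finset.card_insert_of_notMem (by simp [lowPart]), ih (by omega)]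

lemma card_highPart {k : ℕ} (h : k ≤ n) : (highPart n k).card = n - k := by
  have h1 : highPart n k = (lowPart n k)ᶜ := by
    ext i
    simp [highPart, lowPart]
  rw [h1, Finset.card_compl, card_lowPart h, Fintype.card_fin]

/-- The recursion that makes the alternating sum of the traces
`tr A_{1..k} H_{k+1..n} X` telescope. -/
lemma ManinRel.trace_recursion (hX : ManinRel ρ X)
    (htr : ∀ σ Y, tr (ρ σ * Y) = tr (Y * ρ σ)) {k : ℕ} (hk : k ≤ n) :
    n • tr (twistedSum ρ Perm.sign (lowPart n k) * twistedSum ρ 1 (highPart n k) * X)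
      = (n - k) • tr (twistedSum ρ Perm.sign (lowPart n (k + 1)) * X
          * twistedSum ρ 1 (highPart n k))
        + k • tr (twistedSum ρ Perm.sign (lowPart n k) * X
          * twistedSum ρ 1 (highPart n (k - 1))) := by
  have hdis := disjoint_lowPart_highPart n k
  have hcS := card_lowPart hk
  have hcT := card_highPart hk
  obtain ⟨z, hz⟩ := exists_sandwich_swap_eq (ρ := ρ) (χ := Perm.sign) (χ' := 1) hdis
  have hcomm := (twistedSum_commute (ρ := ρ) (χ := Perm.sign) (χ' := 1) hdis).eq
  have hSX := hX.mul_antisymm (lowPart_ordConnected n k)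
  have hXT := hX.symm_mul (highPart_ordConnected n k)
  rw [hcS] at hSX
  rw [hcT] at hXT
  have hup : k < n →
      (k.factorial * (n - k).factorial) • tr (twistedSum ρ Perm.sign (lowPart n (k + 1)) * X
          * twistedSum ρ 1 (highPart n k)) + k • tr (z * X)
        = (k.factorial * (n - k).factorial) •
          tr (twistedSum ρ Perm.sign (lowPart n k) * twistedSum ρ 1 (highPart n k) * X) := by
    intro hkn
    have h1 := twistedSum_insert_sandwich (ρ := ρ) (χ := Perm.sign) (χ' := 1) hdis
      (x := ⟨k, hkn⟩) (by simp [highPart]) (ε := -1)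
      (fun i hi => sign_swap_int (by rintro rfl; simp [lowPart] at hi)) (z := z)
      (fun i hi => by rw [swap_comm]; exact hz i hi _ (by simp [highPart]))
    rw [hcS, hcT, ← lowPart_succ hkn, mul_smul] at h1
    have h2 := congrArg (fun Y => tr (Y * X)) (nsmul_right_cancel k.factorial_ne_zero h1)
    simp only [neg_smul, one_smul, smul_neg, add_mul, neg_mul, smul_mul_assoc, map_add, map_neg,
      map_nsmul] at h2
    rw [mul_assoc, mul_assoc, trace_twistedSum_comm htr, mul_assoc, mul_assoc, hXT,
      mul_smul_comm, map_nsmul, smul_smul, ← mul_assoc] at h2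
    rw [h2, neg_add_cancel_right]
  have hdown : 0 < k →
      (k.factorial * (n - k).factorial) • tr (twistedSum ρ Perm.sign (lowPart n k) * X
          * twistedSum ρ 1 (highPart n (k - 1)))
        = (k.factorial * (n - k).factorial) •
          tr (twistedSum ρ Perm.sign (lowPart n k) * twistedSum ρ 1 (highPart n k) * X)
          + (n - k) • tr (z * X) := by
    intro hk0
    have hkn : k - 1 < n := by omega
    have h1 := twistedSum_insert_sandwich (ρ := ρ) (χ := 1) (χ' := Perm.sign) hdis.symm
      (x := ⟨k - 1, hkn⟩) (by simp [lowPart, hk0]) (ε := 1)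
      (fun i hi => rfl) (z := z)
      (fun i hi => by rw [← hcomm]; exact hz _ (by simp [lowPart, hk0]) i hi)
    have h3 := highPart_eq_insert hkn
    rw [Nat.sub_add_cancel hk0] at h3
    rw [hcS, hcT, ← h3, mul_smul, ← hcomm] at h1
    have h2 := congrArg (fun Y => tr (Y * X)) (nsmul_right_cancel (n - k).factorial_ne_zero h1)
    simp only [one_smul, add_mul, smul_mul_assoc, map_add, map_nsmul] at h2
    rw [mul_assoc, mul_assoc, trace_twistedSum_comm htr, mul_assoc, hSX,
      mul_smul_comm, map_nsmul, smul_smul, trace_twistedSum_comm htr, mul_comm] at h2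
    rw [h2]
  refine nsmul_right_cancel
    (Nat.mul_ne_zero k.factorial_ne_zero (n - k).factorial_ne_zero) ?_
  obtain ⟨l, rfl⟩ := Nat.exists_eq_add_of_le hk
  simp only [Nat.add_sub_cancel_left] at *
  rcases Nat.eq_zero_or_pos k with rfl | hk0
  · rcases Nat.eq_zero_or_pos l with rfl | hl0
    · simp
    · linear_combination (norm := module) -((l : ℤ) • hup (by omega))
  · rcases Nat.eq_zero_or_pos l with rfl | hl0
    · linear_combination (norm := module) -((k : ℤ) • hdown hk0)
    · linear_combination (norm := module) -((l : ℤ) • hup (by omega)) - (k : ℤ) • hdown hk0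

lemma alternating_sum_telescope {B : Type*} [AddCommGroup B] (v : ℕ → B) (m : ℕ) :
    ∑ k ∈ Finset.range m, ((-1 : ℤ) ^ k) • (v (k + 1) + v k) = v 0 - ((-1 : ℤ) ^ m) • v m := by
  induction m with
  | zero => simp
  | succ m ih =>
    rw [Finset.sum_range_succ, ih, pow_succ]
    module

lemma ManinRel.alternating_trace_sum (hX : ManinRel ρ X)
    (htr : ∀ σ Y, tr (ρ σ * Y) = tr (Y * ρ σ)) (hn : n ≠ 0) :
    ∑ k ∈ Finset.range (n + 1), ((-1 : ℤ) ^ k) •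
      (((k.factorial : ℂ) * ((n - k).factorial : ℂ))⁻¹ •
        tr (twistedSum ρ Perm.sign (lowPart n k) * twistedSum ρ 1 (highPart n k) * X)) = 0 := by
  let u : ℕ → B := fun k =>
    tr (twistedSum ρ Perm.sign (lowPart n (k + 1)) * X * twistedSum ρ 1 (highPart n k))
  let v : ℕ → B := fun k => if k = 0 ∨ n < k then 0 else
    (((k - 1).factorial : ℂ) * ((n - k).factorial : ℂ))⁻¹ • u (k - 1)
  refine nsmul_right_cancel hn ?_
  rw [smul_zero, Finset.smul_sum]
  have key : ∀ k ∈ Finset.range (n + 1), n • (((-1 : ℤ) ^ k) •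
      (((k.factorial : ℂ) * ((n - k).factorial : ℂ))⁻¹ •
        tr (twistedSum ρ Perm.sign (lowPart n k) * twistedSum ρ 1 (highPart n k) * X)))
      = ((-1 : ℤ) ^ k) • (v (k + 1) + v k) := by
    intro k hk
    have hkn : k ≤ n := by simpa [Nat.lt_succ_iff] using hk
    rw [smul_comm n, smul_comm n, hX.trace_recursion htr hkn]
    congr 1
    rw [smul_add]
    congr 1
    · rcases Nat.eq_or_lt_of_le hkn with rfl | hlt
      · simp [v]
      · simp only [v, u]
        rw [if_neg (by omega), Nat.add_sub_cancel, ← Nat.cast_smul_eq_nsmul ℂ, smul_smul]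
        congr 1
        obtain ⟨l, rfl⟩ := Nat.exists_eq_add_of_lt hlt
        have e1 : k + l + 1 - k = l + 1 := by omega
        have e2 : k + l + 1 - (k + 1) = l := by omega
        rw [e1, e2, Nat.factorial_succ]
        have := Nat.factorial_ne_zero k
        have := Nat.factorial_ne_zero l
        have : (l : ℂ) + 1 ≠ 0 := Nat.cast_add_one_ne_zero l
        push_cast
        field_simp
    · rcases k with _ | k
      · simp [v]
      · simp only [v, u]
        rw [if_neg (by omega), Nat.add_sub_cancel, ← Nat.cast_smul_eq_nsmul ℂ, smul_smul]
        congr 1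
        rw [Nat.factorial_succ]
        have := Nat.factorial_ne_zero k
        have := Nat.factorial_ne_zero (n - (k + 1))
        have : (k : ℂ) + 1 ≠ 0 := Nat.cast_add_one_ne_zero k
        push_cast
        field_simp
  rw [Finset.sum_congr rfl key, alternating_sum_telescope]
  simp [v]

end TraceRelation

section PermMatrix

variable {N : ℕ}

/-- Permutation of tensor factors, as a matrix indexed by `Fin m → Fin N`. -/
def tensorPerm (A : Type*) [Ring A] (N m : ℕ) :
    Perm (Fin m) →* Matrix (Fin m → Fin N) (Fin m → Fin N) A where
  toFun σ := Matrix.of fun f g => if f ∘ σ = g then 1 else 0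
  map_one' := by
    ext f g
    simp [Matrix.one_apply]
  map_mul' σ τ := by
    ext f g
    rw [Matrix.mul_apply, Finset.sum_eq_single (f ∘ σ)]
    · simp only [Matrix.of_apply, if_true, one_mul, Perm.coe_mul, Function.comp_assoc]
      congr
    · intro h _ hne
      simp [hne.symm]
    · simp

lemma tensorPerm_apply {A : Type*} [Ring A] {m : ℕ} (σ : Perm (Fin m)) (f g : Fin m → Fin N) :
    tensorPerm A N m σ f g = if f ∘ σ = g then 1 else 0 := rfl

lemma tensorPerm_mul_apply {A : Type*} [Ring A] {m : ℕ} (σ : Perm (Fin m))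
    (Y : Matrix (Fin m → Fin N) (Fin m → Fin N) A) (f g : Fin m → Fin N) :
    (tensorPerm A N m σ * Y) f g = Y (f ∘ σ) g := by
  simp [Matrix.mul_apply, tensorPerm_apply]

lemma mul_tensorPerm_apply {A : Type*} [Ring A] {m : ℕ} (σ : Perm (Fin m))
    (Y : Matrix (Fin m → Fin N) (Fin m → Fin N) A) (f g : Fin m → Fin N) :
    (Y * tensorPerm A N m σ) f (g ∘ σ) = Y f g := by
  have h : ∀ h : Fin m → Fin N, h ∘ σ = g ∘ σ ↔ h = g :=
    fun h => σ.surjective.right_cancellable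
  simp [Matrix.mul_apply, tensorPerm_apply, h]

lemma trace_tensorPerm_mul {A : Type*} [Ring A] {m : ℕ} (σ : Perm (Fin m))
    (Y : Matrix (Fin m → Fin N) (Fin m → Fin N) A) :
    Matrix.trace (tensorPerm A N m σ * Y) = ∑ f, Y (f ∘ σ) f := by
  simp [Matrix.trace, tensorPerm_mul_apply]

lemma trace_tensorPerm_comm {A : Type*} [Ring A] {m : ℕ} (σ : Perm (Fin m))
    (Y : Matrix (Fin m → Fin N) (Fin m → Fin N) A) :
    Matrix.trace (tensorPerm A N m σ * Y) = Matrix.trace (Y * tensorPerm A N m σ) := by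
  rw [trace_tensorPerm_mul, Matrix.trace]
  refine Fintype.sum_equiv (σ.symm.arrowCongr (Equiv.refl (Fin N))) _ _ fun f => ?_
  have h : σ.symm.arrowCongr (Equiv.refl (Fin N)) f = f ∘ σ := by
    ext; simp [Equiv.arrowCongr]
  rw [h, Matrix.diag_apply, mul_tensorPerm_apply]

lemma prod_map_Mfac_apply {A : Type*} [Ring A] (M : Matrix (Fin N) (Fin N) A) {m : ℕ}
    (l : List (Fin m)) (hl : l.Nodup) (f g : Fin m → Fin N) :
    (l.map (Mfac N M m)).prod f g
      = if ∀ b, b ∉ l → f b = g b then (l.map fun a => M (f a) (g a)).prod else 0 := by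
  induction l generalizing f with
  | nil => simp [Matrix.one_apply, funext_iff]
  | cons a l ih =>
    rw [List.nodup_cons] at hl
    rw [List.map_cons, List.prod_cons, Matrix.mul_apply, List.map_cons, List.prod_cons,
      Finset.sum_eq_single (Function.update f a (g a))]
    · rw [ih hl.2]
      have h1 : (∀ b, b ∉ l → Function.update f a (g a) b = g b)
          ↔ ∀ b, b ∉ a :: l → f b = g b := by
        refine forall_congr' fun b => ?_
        by_cases hb : b = a
        · subst hb; simp
        · simp [hb]
      have h2 : (l.map fun c => M (Function.update f a (g a) c) (g c))
          = l.map fun c => M (f c) (g c) := by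
        refine List.map_congr_left fun c hc => ?_
        rw [Function.update_of_ne]
        rintro rfl
        exact hl.1 hc
      have h3 : Mfac N M m a f (Function.update f a (g a)) = M (f a) (g a) := by
        rw [Mfac, if_pos, Function.update_self]
        intro b hb
        rw [Function.update_of_ne hb]
      rw [h2, h3]
      simp only [h1, mul_ite, mul_zero]
    · intro h _ hne
      rw [ih hl.2, Mfac]
      by_cases h1 : ∀ b, b ≠ a → f b = h b
      · rw [if_neg (c := ∀ b, b ∉ l → h b = g b), mul_zero]
        intro h2
        refine hne (funext fun b => ?_)
        by_cases hb : b = a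
        · subst hb; rw [h2 b hl.1, Function.update_self]
        · rw [Function.update_of_ne hb, h1 b hb]
      · rw [if_neg h1, zero_mul]
    · simp

lemma prodM_apply {A : Type*} [Ring A] (M : Matrix (Fin N) (Fin N) A) {m : ℕ}
    (f g : Fin m → Fin N) :
    prodM N M m f g = (List.ofFn fun a => M (f a) (g a)).prod := by
  rw [prodM, List.ofFn_eq_map, prod_map_Mfac_apply M _ (List.nodup_finRange m),
    List.ofFn_eq_map, if_pos]
  intro b hb
  exact absurd (List.mem_finRange b) hb

/-- Four ordered products that agree away from two adjacent positions satisfy any linear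
relation with signs `+ - + -` satisfied by the products of their entries there. -/
lemma ofFn_prod_relation {A : Type*} [Ring A] {m : ℕ} (F₁ F₂ F₃ F₄ : Fin m → A) (i j : Fin m)
    (hij : i.val + 1 = j.val)
    (h₂ : ∀ a, a ≠ i → a ≠ j → F₂ a = F₁ a) (h₃ : ∀ a, a ≠ i → a ≠ j → F₃ a = F₁ a)
    (h₄ : ∀ a, a ≠ i → a ≠ j → F₄ a = F₁ a)
    (h : F₁ i * F₁ j - F₂ i * F₂ j + F₃ i * F₃ j - F₄ i * F₄ j = 0) :
    (List.ofFn F₁).prod - (List.ofFn F₂).prod + (List.ofFn F₃).prod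
      - (List.ofFn F₄).prod = 0 := by
  induction m with
  | zero => exact i.elim0
  | succ m ih =>
    obtain ⟨j, rfl⟩ : ∃ j' : Fin m, j = j'.succ :=
      ⟨j.pred (by rintro rfl; simp at hij), by simp⟩
    rcases Fin.eq_zero_or_eq_succ i with rfl | ⟨i, rfl⟩
    · obtain ⟨m, rfl⟩ : ∃ m', m = m' + 1 := ⟨m - 1, by have := j.isLt; omega⟩
      obtain rfl : j = 0 := by
        ext; simp at hij; simp [← hij]
      have tail : ∀ F : Fin (m + 1 + 1) → A,
          (∀ a, a ≠ 0 → a ≠ Fin.succ 0 → F a = F₁ a) →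
          (fun a : Fin m => F a.succ.succ) = fun a => F₁ a.succ.succ :=
        fun F hF => funext fun a => hF _ (Fin.succ_ne_zero _)
          (fun h => Fin.succ_ne_zero a (Fin.succ_injective _ h))
      simp only [List.ofFn_succ, List.prod_cons, tail F₂ h₂, tail F₃ h₃, tail F₄ h₄, ← mul_assoc]
      rw [← sub_mul, ← add_mul, ← sub_mul, h, zero_mul]
    · have z1 : (0 : Fin (m + 1)) ≠ i.succ := (Fin.succ_ne_zero i).symm
      have z2 : (0 : Fin (m + 1)) ≠ j.succ := (Fin.succ_ne_zero j).symm
      have := ih (fun a => F₁ a.succ) (fun a => F₂ a.succ) (fun a => F₃ a.succ)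
        (fun a => F₄ a.succ) i j (by simpa using hij)
        (fun a ha hb => h₂ _ (by simpa using ha) (by simpa using hb))
        (fun a ha hb => h₃ _ (by simpa using ha) (by simpa using hb))
        (fun a ha hb => h₄ _ (by simpa using ha) (by simpa using hb)) h
      simp only [List.ofFn_succ, List.prod_cons, h₂ 0 z1 z2, h₃ 0 z1 z2, h₄ 0 z1 z2]
      rw [← mul_sub, ← mul_add, ← mul_sub, this, mul_zero]

lemma IsManin.maninRel {A : Type*} [Ring A] {M : Matrix (Fin N) (Fin N) A} (hM : IsManin M)
    (m : ℕ) :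
    ManinRel (tensorPerm A N m) (prodM N M m) := by
  intro i j hij
  ext f g'
  obtain ⟨g, rfl⟩ : ∃ g, g' = g ∘ swap i j := ⟨g' ∘ swap i j, by
    rw [Function.comp_assoc, ← Perm.coe_mul, swap_mul_self]; rfl⟩
  have hs : ∀ a, a ≠ i → a ≠ j → swap i j a = a := fun a => swap_apply_of_ne_of_ne
  have key := ofFn_prod_relation
    (fun a => M (f a) (g (swap i j a))) (fun a => M (f (swap i j a)) (g (swap i j a)))
    (fun a => M (f a) (g a)) (fun a => M (f (swap i j a)) (g a)) i j hij
    (fun a h1 h2 => by simp only [hs a h1 h2]) (fun a h1 h2 => by simp only [hs a h1 h2])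
    (fun a h1 h2 => by simp only [hs a h1 h2]) (by
      simp only [swap_apply_left, swap_apply_right]
      have := hM (f i) (g j) (f j) (g i)
      rw [← sub_eq_zero] at this
      rw [← this]
      abel)
  rw [mul_add, mul_one, sub_mul, one_mul, Matrix.add_apply, mul_tensorPerm_apply,
    Matrix.sub_apply, Matrix.sub_apply, tensorPerm_mul_apply, tensorPerm_mul_apply,
    prodM_apply, prodM_apply, prodM_apply, prodM_apply, Matrix.zero_apply, ← key]
  simp only [Function.comp_apply]
  abel

lemma permsOn_univ (m : ℕ) : permsOn (Finset.univ : Finset (Fin m)) = Finset.univ := by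
  ext σ; simp [mem_permsOn]

lemma twistedSum_univ_apply {m : ℕ} (χ : Perm (Fin m) →* ℤˣ) (f g : Fin m → Fin N) :
    (((m.factorial : ℂ)⁻¹) • twistedSum (tensorPerm A N m) χ Finset.univ) f g
      = algebraMap ℂ A ((m.factorial : ℂ)⁻¹ *
        ∑ σ : Perm (Fin m), if ∀ b : Fin m, f b = g (σ b) then (((χ σ : ℤˣ) : ℤ) : ℂ) else 0) := by
  rw [Matrix.smul_apply, Algebra.smul_def, map_mul, twistedSum, permsOn_univ, Matrix.sum_apply,
    map_sum]
  congr 1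
  refine Fintype.sum_equiv (Equiv.inv _) _ _ fun σ => ?_
  have h : (∀ b, f b = g ((Equiv.inv _ σ : Perm (Fin m)) b)) ↔ f ∘ σ = g := by
    rw [funext_iff]
    constructor
    · intro h b; simp [h]
    · intro h b; simp [← h]
  have hχ : χ (Equiv.inv _ σ) = χ σ := by
    rw [Equiv.inv_apply, map_inv, Int.units_inv_eq_self]
  rw [Matrix.smul_apply, tensorPerm_apply, hχ]
  by_cases h' : f ∘ σ = g
  · rw [if_pos h', if_pos (h.2 h')]; simp
  · rw [if_neg h', if_neg (fun h2 => h' (h.1 h2))]; simp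

lemma AsymM_eq (m : ℕ) : (AsymM N m : Matrix _ _ A)
    = ((m.factorial : ℂ)⁻¹) • twistedSum (tensorPerm A N m) Perm.sign Finset.univ := by
  ext f g
  rw [twistedSum_univ_apply, AsymM]

lemma HsymM_eq (m : ℕ) : (HsymM N m : Matrix _ _ A)
    = ((m.factorial : ℂ)⁻¹) • twistedSum (tensorPerm A N m) 1 Finset.univ := by
  ext f g
  rw [twistedSum_univ_apply, HsymM]
  simp

lemma AsymM_eq_zero {m : ℕ} (h : N < m) : (AsymM N m : Matrix _ _ A) = 0 := by
  ext f g
  obtain ⟨i, j, hne, hij⟩ : ∃ i j, i ≠ j ∧ g i = g j :=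
    Fintype.exists_ne_map_eq_of_card_lt g (by simpa using h)
  have hg : ∀ a, g (swap i j a) = g a := by
    intro a
    by_cases hi : a = i
    · subst hi; simp [hij]
    by_cases hj : a = j
    · subst hj; simp [hij]
    rw [swap_apply_of_ne_of_ne hi hj]
  rw [AsymM, Finset.sum_involution (fun σ _ => swap i j * σ)]
  · simp
  · intro σ _
    simp only [Perm.mul_apply, hg, Perm.sign_mul, Perm.sign_swap hne]
    split_ifs <;> simp
  · intro σ _ _ h
    exact hne (swap_eq_one_iff.1 (mul_eq_right.1 h))
  · simp
  · simp [← mul_assoc]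

end PermMatrix

section Blocks

variable {N k l : ℕ}

/-- The permutation of `Fin (k + l)` acting by `σ` on the first block and `τ` on the second. -/
def blockPerm (σ : Perm (Fin k)) (τ : Perm (Fin l)) : Perm (Fin (k + l)) :=
  finSumFinEquiv.permCongr (Perm.sumCongr σ τ)

lemma blockPerm_castAdd (σ : Perm (Fin k)) (τ : Perm (Fin l)) (i : Fin k) :
    blockPerm σ τ (Fin.castAdd l i) = Fin.castAdd l (σ i) := by
  simp [blockPerm, Equiv.permCongr_apply]

lemma blockPerm_natAdd (σ : Perm (Fin k)) (τ : Perm (Fin l)) (i : Fin l) :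
    blockPerm σ τ (Fin.natAdd k i) = Fin.natAdd k (τ i) := by
  simp [blockPerm, Equiv.permCongr_apply]

lemma sign_blockPerm (σ : Perm (Fin k)) (τ : Perm (Fin l)) :
    Perm.sign (blockPerm σ τ) = Perm.sign σ * Perm.sign τ := by
  rw [blockPerm, Perm.sign_permCongr, Perm.sign_sumCongr]

lemma blockPerm_mul_blockPerm (σ : Perm (Fin k)) (τ : Perm (Fin l)) :
    blockPerm σ 1 * blockPerm 1 τ = blockPerm σ τ := by
  ext a
  refine Fin.addCases (fun i => ?_) (fun i => ?_) a
  · simp [blockPerm_castAdd]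
  · simp [blockPerm_natAdd]

lemma append_comp_blockPerm {α : Type*} (f₁ : Fin k → α) (f₂ : Fin l → α) (σ : Perm (Fin k))
    (τ : Perm (Fin l)) :
    Fin.append f₁ f₂ ∘ blockPerm σ τ = Fin.append (f₁ ∘ σ) (f₂ ∘ τ) := by
  ext a
  refine Fin.addCases (fun i => ?_) (fun i => ?_) a
  · simp [blockPerm_castAdd]
  · simp [blockPerm_natAdd]

lemma exists_blockPerm_of_mapsTo {π : Perm (Fin (k + l))}
    (h : ∀ i : Fin k, ∃ j : Fin k, π (Fin.castAdd l i) = Fin.castAdd l j) :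
    ∃ σ τ, blockPerm σ τ = π := by
  have h1 : Set.MapsTo (finSumFinEquiv.symm.permCongr π)
      (Set.range (Sum.inl : Fin k → Fin k ⊕ Fin l)) (Set.range Sum.inl) := by
    rintro _ ⟨i, rfl⟩
    obtain ⟨j, hj⟩ := h i
    exact ⟨j, by simp [Equiv.permCongr_apply, hj]⟩
  obtain ⟨⟨σ, τ⟩, h2⟩ := Perm.mem_sumCongrHom_range_of_perm_mapsTo_inl h1
  refine ⟨σ, τ, ?_⟩
  rw [Perm.sumCongrHom_apply] at h2
  rw [blockPerm, h2]
  ext a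
  simp [Equiv.permCongr_apply]

lemma castAdd_mem_lowPart (i : Fin k) : Fin.castAdd l i ∈ lowPart (k + l) k := by
  simp [lowPart]

lemma natAdd_mem_highPart (i : Fin l) : Fin.natAdd k i ∈ highPart (k + l) k := by
  simp [highPart]

variable {R : Type*} [Ring R] (ρ : Perm (Fin (k + l)) →* R)

lemma twistedSum_sign_lowPart :
    twistedSum ρ Perm.sign (lowPart (k + l) k)
      = ∑ σ : Perm (Fin k), ((Perm.sign σ : ℤˣ) : ℤ) • ρ (blockPerm σ 1) := by
  symm
  refine Finset.sum_nbij (fun σ => blockPerm σ 1) ?_ ?_ ?_ ?_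
  · intro σ _
    rw [mem_permsOn]
    refine Fin.addCases (fun i hi => absurd (castAdd_mem_lowPart i) hi) (fun i _ => ?_)
    rw [blockPerm_natAdd]; rfl
  · intro σ _ τ _ h
    ext i
    have := DFunLike.congr_fun h (Fin.castAdd l i)
    simpa [blockPerm_castAdd, Fin.ext_iff] using this
  · intro π hπ
    have hπ' := mem_permsOn.1 (Finset.mem_coe.1 hπ)
    obtain ⟨σ, τ, rfl⟩ := exists_blockPerm_of_mapsTo (π := π) fun i =>
      ⟨⟨_, (Finset.mem_filter.1
        (apply_mem_of_mem_permsOn (Finset.mem_coe.1 hπ) (castAdd_mem_lowPart i))).2⟩, rfl⟩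
    obtain rfl : τ = 1 := by
      ext i
      have := hπ' (Fin.natAdd k i) (Finset.disjoint_right.1
        (disjoint_lowPart_highPart _ _) (natAdd_mem_highPart i))
      rw [blockPerm_natAdd] at this
      simpa [Fin.ext_iff] using this
    exact ⟨σ, by simp, rfl⟩
  · intro σ _
    simp [sign_blockPerm]

lemma twistedSum_one_highPart :
    twistedSum ρ 1 (highPart (k + l) k) = ∑ τ : Perm (Fin l), ρ (blockPerm 1 τ) := by
  symm
  refine Finset.sum_nbij (fun τ => blockPerm 1 τ) ?_ ?_ ?_ ?_
  · intro τ _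
    rw [mem_permsOn]
    refine Fin.addCases (fun i _ => ?_) (fun i hi => absurd (natAdd_mem_highPart i) hi)
    rw [blockPerm_castAdd]; rfl
  · intro σ _ τ _ h
    ext i
    have := DFunLike.congr_fun h (Fin.natAdd k i)
    simpa [blockPerm_natAdd, Fin.ext_iff] using this
  · intro π hπ
    have hπ' : ∀ i : Fin k, π (Fin.castAdd l i) = Fin.castAdd l i := fun i =>
      mem_permsOn.1 (Finset.mem_coe.1 hπ) _ (Finset.disjoint_left.1
        (disjoint_lowPart_highPart _ _) (castAdd_mem_lowPart i))
    obtain ⟨σ, τ, rfl⟩ := exists_blockPerm_of_mapsTo (π := π) fun i => ⟨i, hπ' i⟩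
    obtain rfl : σ = 1 := by
      ext i
      have := hπ' i
      rw [blockPerm_castAdd] at this
      simpa [Fin.ext_iff] using this
    exact ⟨τ, by simp, rfl⟩
  · intro σ _
    simp

lemma trace_blockPerm {A : Type*} [Ring A] (M : Matrix (Fin N) (Fin N) A)
    (σ : Perm (Fin k)) (τ : Perm (Fin l)) :
    Matrix.trace (tensorPerm A N (k + l) (blockPerm σ τ) * prodM N M (k + l))
      = Matrix.trace (tensorPerm A N k σ * prodM N M k)
        * Matrix.trace (tensorPerm A N l τ * prodM N M l) := by
  simp only [trace_tensorPerm_mul, prodM_apply]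
  rw [Finset.sum_mul_sum, ← Finset.sum_product', Finset.univ_product_univ]
  symm
  refine Finset.sum_bij' (fun q _ => Fin.append q.1 q.2)
    (fun f _ => (fun i => f (Fin.castAdd l i), fun i => f (Fin.natAdd k i)))
    (by simp) (by simp) (by simp) (fun f _ => Fin.append_castAdd_natAdd) ?_
  rintro ⟨f₁, f₂⟩ _
  rw [append_comp_blockPerm, ← List.prod_append, ← List.ofFn_fin_append]
  congr 2
  ext a
  refine Fin.addCases (fun i => ?_) (fun i => ?_) a
  · simp
  · simp

lemma trace_twistedSum_mul_trace_twistedSum {A : Type*} [Ring A] (M : Matrix (Fin N) (Fin N) A) :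
    Matrix.trace (twistedSum (tensorPerm A N k) Perm.sign Finset.univ * prodM N M k)
        * Matrix.trace (twistedSum (tensorPerm A N l) 1 Finset.univ * prodM N M l)
      = Matrix.trace (twistedSum (tensorPerm A N (k + l)) Perm.sign (lowPart (k + l) k)
        * twistedSum (tensorPerm A N (k + l)) 1 (highPart (k + l) k) * prodM N M (k + l)) := by
  rw [twistedSum_sign_lowPart, twistedSum_one_highPart, twistedSum, twistedSum, permsOn_univ,
    permsOn_univ]
  simp only [Finset.sum_mul, Finset.mul_sum, Matrix.trace_sum, smul_mul_assoc,
    MonoidHom.one_apply, Units.val_one, one_smul, Matrix.trace_smul, ← map_mul,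
    blockPerm_mul_blockPerm, trace_blockPerm]

end Blocks

lemma cdetCoeff_eq_zero {N m : ℕ} (M : Matrix (Fin N) (Fin N) A) (h : N < m) :
    cdetCoeff N M m = 0 := by
  rw [cdetCoeff, AsymM_eq_zero h, zero_mul, Matrix.trace_zero]

lemma cdetCoeff_mul_trace_HsymM {N : ℕ} (M : Matrix (Fin N) (Fin N) A) {n k : ℕ} (hk : k ≤ n) :
    cdetCoeff N M k * Matrix.trace (HsymM N (n - k) * prodM N M (n - k))
      = ((k.factorial : ℂ) * ((n - k).factorial : ℂ))⁻¹ •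
        Matrix.trace (twistedSum (tensorPerm A N n) Perm.sign (lowPart n k)
          * twistedSum (tensorPerm A N n) 1 (highPart n k) * prodM N M n) := by
  obtain ⟨l, rfl⟩ := Nat.exists_eq_add_of_le hk
  rw [Nat.add_sub_cancel_left, cdetCoeff, AsymM_eq, HsymM_eq, smul_mul_assoc, smul_mul_assoc,
    Matrix.trace_smul, Matrix.trace_smul, smul_mul_smul_comm,
    trace_twistedSum_mul_trace_twistedSum, mul_inv]

lemma coeff_cdetNegSeries {N : ℕ} (M : Matrix (Fin N) (Fin N) A) (m : ℕ) :
    PowerSeries.coeff m (cdetNegSeries N M) = ((-1 : ℤ) ^ m) • cdetCoeff N M m := by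
  rw [cdetNegSeries, PowerSeries.coeff_mk]
  split_ifs with h
  · rfl
  · rw [cdetCoeff_eq_zero M (not_le.1 h), smul_zero]

lemma cdetCoeff_zero {N : ℕ} (M : Matrix (Fin N) (Fin N) A) : cdetCoeff N M 0 = 1 := by
  simp [cdetCoeff, AsymM, prodM, Matrix.trace]

lemma trace_HsymM_zero {N : ℕ} (M : Matrix (Fin N) (Fin N) A) :
    Matrix.trace (HsymM N 0 * prodM N M 0) = 1 := by
  simp [HsymM, prodM, Matrix.trace]

lemma cdetNegSeries_mul_permSeries {N : ℕ} {M : Matrix (Fin N) (Fin N) A} (hM : IsManin M) :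
    cdetNegSeries N M * permSeries N M = 1 := by
  ext n
  rw [PowerSeries.coeff_mul, PowerSeries.coeff_one,
    Finset.Nat.sum_antidiagonal_eq_sum_range_succ (fun k l =>
      PowerSeries.coeff k (cdetNegSeries N M) * PowerSeries.coeff l (permSeries N M))]
  simp only [coeff_cdetNegSeries, permSeries, PowerSeries.coeff_mk]
  split_ifs with hn
  · subst hn
    simp [cdetCoeff_zero, trace_HsymM_zero]
  · rw [← (hM.maninRel n).alternating_trace_sum
      (tr := Matrix.traceAddMonoidHom (Fin n → Fin N) A) trace_tensorPerm_comm hn]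
    refine Finset.sum_congr rfl fun k hk => ?_
    rw [smul_mul_assoc, cdetCoeff_mul_trace_HsymM M (Nat.lt_succ_iff.1 (Finset.mem_range.1 hk))]
    rfl

/-- MacMahon Master Theorem for a Manin matrix `M`:
`[cdet(1-zM)]⁻¹ = ∑_{m≥0} z^m tr_{1,…,m} H^{(m)} M₁ ⋯ M_m`, i.e. the two series
are mutually inverse. -/
theorem manin_macmahon (N : ℕ) (M : Matrix (Fin N) (Fin N) A)
    (hM : IsManin M) :
    cdetNegSeries N M * permSeries N M = 1 ∧
      permSeries N M * cdetNegSeries N M = 1 := by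
  have h1 := cdetNegSeries_mul_permSeries hM
  have hunit : IsUnit (cdetNegSeries N M) := by
    rw [PowerSeries.isUnit_iff_constantCoeff, ← PowerSeries.coeff_zero_eq_constantCoeff_apply,
      coeff_cdetNegSeries, cdetCoeff_zero]
    simp
  refine ⟨h1, hunit.mul_left_cancel ?_⟩
  rw [← mul_assoc, h1, one_mul, mul_one]

end
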